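/- A smooth function f ∈ C^∞(ℝ²) satisfies the integral identity ∫_{ℝ²}[ ψ/√(1+ψ²) · Δ^f V + √(1+ψ²) · ∂_τ V ] dη dτ = 0 for all V ∈ C_c^∞(ℝ²) if and only if (∇^f + 2∂_τ f)∇^f( ψ/√(1+ψ²) ) = 0, where ψ = ∇^f f. -/

import Mathlib

noncomputable def pd1 (u : ℝ → ℝ → ℝ) (η τ : ℝ) : ℝ := deriv (fun x => u x τ) η

noncomputable def pd2 (u : ℝ → ℝ → ℝ) (η τ : ℝ) : ℝ := deriv (fun y => u η y) τ

/-- The intrinsic gradient operator `∇^f = ∂_η + f ∂_τ`. -/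
noncomputable def nab (f u : ℝ → ℝ → ℝ) : ℝ → ℝ → ℝ :=
  fun η τ => pd1 u η τ + f η τ * pd2 u η τ

open MeasureTheory Function

section PartialDerivatives

variable {u v : ℝ → ℝ → ℝ}

theorem hasDerivAt_pd1 (hu : ContDiff ℝ (⊤ : ℕ∞) (uncurry u)) (η τ : ℝ) :
    HasDerivAt (fun x => u x τ) (pd1 u η τ) η := by
  have h : ContDiff ℝ (⊤ : ℕ∞) (fun x => uncurry u (x, τ)) := by fun_prop
  exact (h.differentiable (by simp) η).hasDerivAt

theorem hasDerivAt_pd2 (hu : ContDiff ℝ (⊤ : ℕ∞) (uncurry u)) (η τ : ℝ) :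
    HasDerivAt (fun y => u η y) (pd2 u η τ) τ := by
  have h : ContDiff ℝ (⊤ : ℕ∞) (fun y => uncurry u (η, y)) := by fun_prop
  exact (h.differentiable (by simp) τ).hasDerivAt

theorem pd1_eq_fderiv (hu : ContDiff ℝ (⊤ : ℕ∞) (uncurry u)) (η τ : ℝ) :
    pd1 u η τ = fderiv ℝ (uncurry u) (η, τ) (1, 0) := by
  have h := (hu.differentiable (by simp) (η, τ)).hasFDerivAt
  exact (h.comp_hasDerivAt η ((hasDerivAt_id η).prodMk (hasDerivAt_const η τ))).deriv

theorem pd2_eq_fderiv (hu : ContDiff ℝ (⊤ : ℕ∞) (uncurry u)) (η τ : ℝ) :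
    pd2 u η τ = fderiv ℝ (uncurry u) (η, τ) (0, 1) := by
  have h := (hu.differentiable (by simp) (η, τ)).hasFDerivAt
  exact (h.comp_hasDerivAt τ ((hasDerivAt_const τ η).prodMk (hasDerivAt_id τ))).deriv

theorem uncurry_pd1 (hu : ContDiff ℝ (⊤ : ℕ∞) (uncurry u)) :
    uncurry (pd1 u) = fun p => fderiv ℝ (uncurry u) p (1, 0) :=
  funext fun p => pd1_eq_fderiv hu p.1 p.2

theorem uncurry_pd2 (hu : ContDiff ℝ (⊤ : ℕ∞) (uncurry u)) :
    uncurry (pd2 u) = fun p => fderiv ℝ (uncurry u) p (0, 1) :=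
  funext fun p => pd2_eq_fderiv hu p.1 p.2

theorem contDiff_fderiv_uncurry (hu : ContDiff ℝ (⊤ : ℕ∞) (uncurry u)) :
    ContDiff ℝ (⊤ : ℕ∞) (fderiv ℝ (uncurry u)) :=
  hu.fderiv_right (by simp)

theorem contDiff_pd1 (hu : ContDiff ℝ (⊤ : ℕ∞) (uncurry u)) :
    ContDiff ℝ (⊤ : ℕ∞) (uncurry (pd1 u)) := by
  rw [uncurry_pd1 hu]
  exact (contDiff_fderiv_uncurry hu).clm_apply contDiff_const

theorem contDiff_pd2 (hu : ContDiff ℝ (⊤ : ℕ∞) (uncurry u)) :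
    ContDiff ℝ (⊤ : ℕ∞) (uncurry (pd2 u)) := by
  rw [uncurry_pd2 hu]
  exact (contDiff_fderiv_uncurry hu).clm_apply contDiff_const

theorem contDiff_uncurry_add (hu : ContDiff ℝ (⊤ : ℕ∞) (uncurry u))
    (hv : ContDiff ℝ (⊤ : ℕ∞) (uncurry v)) :
    ContDiff ℝ (⊤ : ℕ∞) (uncurry fun a b => u a b + v a b) :=
  hu.add hv

theorem contDiff_uncurry_sub (hu : ContDiff ℝ (⊤ : ℕ∞) (uncurry u))
    (hv : ContDiff ℝ (⊤ : ℕ∞) (uncurry v)) :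
    ContDiff ℝ (⊤ : ℕ∞) (uncurry fun a b => u a b - v a b) :=
  hu.sub hv

theorem contDiff_uncurry_mul (hu : ContDiff ℝ (⊤ : ℕ∞) (uncurry u))
    (hv : ContDiff ℝ (⊤ : ℕ∞) (uncurry v)) :
    ContDiff ℝ (⊤ : ℕ∞) (uncurry fun a b => u a b * v a b) :=
  hu.mul hv

theorem contDiff_nab {f : ℝ → ℝ → ℝ} (hf : ContDiff ℝ (⊤ : ℕ∞) (uncurry f))
    (hu : ContDiff ℝ (⊤ : ℕ∞) (uncurry u)) :
    ContDiff ℝ (⊤ : ℕ∞) (uncurry (nab f u)) :=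
  contDiff_uncurry_add (contDiff_pd1 hu) (contDiff_uncurry_mul hf (contDiff_pd2 hu))

/-- Symmetry of mixed partial derivatives. -/
theorem pd1_pd2_comm (hu : ContDiff ℝ (⊤ : ℕ∞) (uncurry u)) (η τ : ℝ) :
    pd1 (pd2 u) η τ = pd2 (pd1 u) η τ := by
  have hd := (contDiff_fderiv_uncurry hu).differentiable (by simp) (η, τ)
  have hs : IsSymmSndFDerivAt ℝ (uncurry u) (η, τ) :=
    hu.contDiffAt.isSymmSndFDerivAt (by
      rw [minSmoothness_of_isRCLikeNormedField]
      exact WithTop.coe_le_coe.2 le_top)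
  rw [pd1_eq_fderiv (contDiff_pd2 hu), pd2_eq_fderiv (contDiff_pd1 hu), uncurry_pd1 hu,
    uncurry_pd2 hu, fderiv_clm_apply hd (by fun_prop), fderiv_clm_apply hd (by fun_prop)]
  simpa using hs (1, 0) (0, 1)

theorem hasCompactSupport_pd1 (hu : ContDiff ℝ (⊤ : ℕ∞) (uncurry u))
    (hc : HasCompactSupport (uncurry u)) : HasCompactSupport (uncurry (pd1 u)) := by
  rw [uncurry_pd1 hu]
  exact hc.fderiv_apply ℝ (1, 0)

theorem hasCompactSupport_pd2 (hu : ContDiff ℝ (⊤ : ℕ∞) (uncurry u))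
    (hc : HasCompactSupport (uncurry u)) : HasCompactSupport (uncurry (pd2 u)) := by
  rw [uncurry_pd2 hu]
  exact hc.fderiv_apply ℝ (0, 1)

theorem hasCompactSupport_nab {f : ℝ → ℝ → ℝ} (hu : ContDiff ℝ (⊤ : ℕ∞) (uncurry u))
    (hc : HasCompactSupport (uncurry u)) : HasCompactSupport (uncurry (nab f u)) :=
  (hasCompactSupport_pd1 hu hc).add ((hasCompactSupport_pd2 hu hc).mul_left (f := uncurry f))

theorem integral_fderiv_apply_eq_zero {w : ℝ × ℝ → ℝ} (hw : ContDiff ℝ (⊤ : ℕ∞) w)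
    (hc : HasCompactSupport w) (e : ℝ × ℝ) : ∫ p, fderiv ℝ w p e = 0 := by
  have hd : Continuous fun p => fderiv ℝ w p e :=
    (hw.continuous_fderiv (by simp)).clm_apply continuous_const
  have h := integral_mul_fderiv_eq_neg_fderiv_mul_of_integrable (μ := (volume : Measure (ℝ × ℝ)))
    (f := fun _ => (1 : ℝ)) (g := w) (v := e) (by simp)
    (by simpa using hd.integrable_of_hasCompactSupport (hc.fderiv_apply ℝ e))
    (by simpa using hw.continuous.integrable_of_hasCompactSupport hc)
    (fun _ _ => by fun_prop) (fun x _ => hw.differentiable (by simp) x)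
  simpa using h

theorem integrable_and_integral_pd1 (hu : ContDiff ℝ (⊤ : ℕ∞) (uncurry u))
    (hc : HasCompactSupport (uncurry u)) :
    Integrable (fun p : ℝ × ℝ => pd1 u p.1 p.2) ∧ ∫ p : ℝ × ℝ, pd1 u p.1 p.2 = 0 := by
  refine ⟨(contDiff_pd1 hu).continuous.integrable_of_hasCompactSupport
    (hasCompactSupport_pd1 hu hc), ?_⟩
  simpa only [pd1_eq_fderiv hu] using integral_fderiv_apply_eq_zero hu hc (1, 0)

theorem integrable_and_integral_pd2 (hu : ContDiff ℝ (⊤ : ℕ∞) (uncurry u))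
    (hc : HasCompactSupport (uncurry u)) :
    Integrable (fun p : ℝ × ℝ => pd2 u p.1 p.2) ∧ ∫ p : ℝ × ℝ, pd2 u p.1 p.2 = 0 := by
  refine ⟨(contDiff_pd2 hu).continuous.integrable_of_hasCompactSupport
    (hasCompactSupport_pd2 hu hc), ?_⟩
  simpa only [pd2_eq_fderiv hu] using integral_fderiv_apply_eq_zero hu hc (0, 1)

end PartialDerivatives

/-- Integrating by parts in `∫ (g · Δ^f V + h · ∂_τ V)` moves all derivatives off `V`, using that
the adjoint of `∇^f` is `-∇^f - ∂_τ f`. -/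
theorem integral_mul_nab_nab_add_mul_pd2 {f g h V : ℝ → ℝ → ℝ}
    (hf : ContDiff ℝ (⊤ : ℕ∞) (uncurry f)) (hg : ContDiff ℝ (⊤ : ℕ∞) (uncurry g))
    (hh : ContDiff ℝ (⊤ : ℕ∞) (uncurry h)) (hV : ContDiff ℝ (⊤ : ℕ∞) (uncurry V))
    (hc : HasCompactSupport (uncurry V)) :
    ∫ p : ℝ × ℝ, (g p.1 p.2 * nab f (nab f V) p.1 p.2 + h p.1 p.2 * pd2 V p.1 p.2)
      = ∫ p : ℝ × ℝ, V p.1 p.2 * (nab f (nab f g) p.1 p.2 + 2 * pd2 f p.1 p.2 * nab f g p.1 p.2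
          + (nab f (pd2 f) p.1 p.2 + pd2 f p.1 p.2 ^ 2) * g p.1 p.2 - pd2 h p.1 p.2) := by
  have hDV := contDiff_nab hf hV
  have hDg := contDiff_nab hf hg
  have hft := contDiff_pd2 hf
  set W : ℝ → ℝ → ℝ := fun a b => nab f g a b + pd2 f a b * g a b with hW_def
  have hW : ContDiff ℝ (⊤ : ℕ∞) (uncurry W) :=
    contDiff_uncurry_add hDg (contDiff_uncurry_mul hft hg)
  set A : ℝ → ℝ → ℝ := fun a b => g a b * nab f V a b - W a b * V a b with hA_def
  have hA : ContDiff ℝ (⊤ : ℕ∞) (uncurry A) :=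
    contDiff_uncurry_sub (contDiff_uncurry_mul hg hDV) (contDiff_uncurry_mul hW hV)
  set B : ℝ → ℝ → ℝ := fun a b => f a b * A a b + h a b * V a b
  have hB : ContDiff ℝ (⊤ : ℕ∞) (uncurry B) :=
    contDiff_uncurry_add (contDiff_uncurry_mul hf hA) (contDiff_uncurry_mul hh hV)
  have hAc : HasCompactSupport (uncurry A) :=
    ((hasCompactSupport_nab (f := f) hV hc).mul_left (f := uncurry g)).sub
      (hc.mul_left (f := uncurry W))
  have hBc : HasCompactSupport (uncurry B) :=
    (hAc.mul_left (f := uncurry f)).add (hc.mul_left (f := uncurry h))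
  set R : ℝ → ℝ → ℝ := fun a b => V a b * (nab f (nab f g) a b + 2 * pd2 f a b * nab f g a b
    + (nab f (pd2 f) a b + pd2 f a b ^ 2) * g a b - pd2 h a b) with hR_def
  have hRi : Integrable (fun p : ℝ × ℝ => R p.1 p.2) := by
    have c1 := hV.continuous
    have c2 := (contDiff_nab hf hDg).continuous
    have c3 := hft.continuous
    have c4 := hDg.continuous
    have c5 := (contDiff_nab hf hft).continuous
    have c6 := hg.continuous
    have c7 := (contDiff_pd2 hh).continuous
    have hcont : Continuous (uncurry R) := c1.mul ((((c2.add ((continuous_const.mul c3).mul c4)).add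
      ((c5.add (c3.pow 2)).mul c6))).sub c7)
    exact hcont.integrable_of_hasCompactSupport hc.mul_right
  have key : ∀ η τ : ℝ, g η τ * nab f (nab f V) η τ + h η τ * pd2 V η τ
      = pd1 A η τ + pd2 B η τ + R η τ := by
    intro η τ
    have hW1 : pd1 W η τ = _ :=
      ((hasDerivAt_pd1 hDg η τ).add ((hasDerivAt_pd1 hft η τ).mul (hasDerivAt_pd1 hg η τ))).deriv
    have hW2 : pd2 W η τ = _ :=
      ((hasDerivAt_pd2 hDg η τ).add ((hasDerivAt_pd2 hft η τ).mul (hasDerivAt_pd2 hg η τ))).deriv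
    have hA1 : pd1 A η τ = _ :=
      (((hasDerivAt_pd1 hg η τ).mul (hasDerivAt_pd1 hDV η τ)).sub
        ((hasDerivAt_pd1 hW η τ).mul (hasDerivAt_pd1 hV η τ))).deriv
    have hA2 : pd2 A η τ = _ :=
      (((hasDerivAt_pd2 hg η τ).mul (hasDerivAt_pd2 hDV η τ)).sub
        ((hasDerivAt_pd2 hW η τ).mul (hasDerivAt_pd2 hV η τ))).deriv
    have hB2 : pd2 B η τ = _ :=
      (((hasDerivAt_pd2 hf η τ).mul (hasDerivAt_pd2 hA η τ)).add
        ((hasDerivAt_pd2 hh η τ).mul (hasDerivAt_pd2 hV η τ))).deriv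
    have e1 : nab f (nab f V) η τ = pd1 (nab f V) η τ + f η τ * pd2 (nab f V) η τ := rfl
    have e2 : nab f (nab f g) η τ = pd1 (nab f g) η τ + f η τ * pd2 (nab f g) η τ := rfl
    have e3 : nab f (pd2 f) η τ = pd1 (pd2 f) η τ + f η τ * pd2 (pd2 f) η τ := rfl
    have e4 : nab f V η τ = pd1 V η τ + f η τ * pd2 V η τ := rfl
    have e5 : nab f g η τ = pd1 g η τ + f η τ * pd2 g η τ := rfl
    rw [hB2, hA2, hA1, hW1, hW2]
    simp only [hR_def, hA_def, hW_def]
    rw [e1, e2, e3, e4, e5]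
    ring
  obtain ⟨iA, zA⟩ := integrable_and_integral_pd1 hA hAc
  obtain ⟨iB, zB⟩ := integrable_and_integral_pd2 hB hBc
  have iAB : Integrable (fun p : ℝ × ℝ => pd1 A p.1 p.2 + pd2 B p.1 p.2) := iA.add iB
  simp only [key]
  rw [integral_add iAB hRi, integral_add iA iB, zA, zB, add_zero, zero_add]

theorem pd2_nab_self {f : ℝ → ℝ → ℝ} (hf : ContDiff ℝ (⊤ : ℕ∞) (uncurry f)) (η τ : ℝ) :
    pd2 (nab f f) η τ = nab f (pd2 f) η τ + pd2 f η τ ^ 2 := by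
  have h : pd2 (nab f f) η τ = _ :=
    ((hasDerivAt_pd2 (contDiff_pd1 hf) η τ).add
      ((hasDerivAt_pd2 hf η τ).mul (hasDerivAt_pd2 (contDiff_pd2 hf) η τ))).deriv
  rw [h, ← pd1_pd2_comm hf, nab]
  ring

theorem pd2_sqrt_one_add_sq {u : ℝ → ℝ → ℝ} (hu : ContDiff ℝ (⊤ : ℕ∞) (uncurry u)) (η τ : ℝ) :
    pd2 (fun a b => Real.sqrt (1 + u a b ^ 2)) η τ
      = u η τ / Real.sqrt (1 + u η τ ^ 2) * pd2 u η τ := by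
  have h := (((hasDerivAt_pd2 hu η τ).pow 2).const_add 1).sqrt
    (by simp only [Pi.pow_apply]; positivity)
  refine Eq.trans h.deriv ?_
  have : Real.sqrt (1 + u η τ ^ 2) ≠ 0 := by positivity
  simp
  field_simp

theorem stmt_12 (f : ℝ → ℝ → ℝ) (hf : ContDiff ℝ (⊤ : ℕ∞) (Function.uncurry f)) :
    (∀ V : ℝ → ℝ → ℝ, ContDiff ℝ (⊤ : ℕ∞) (Function.uncurry V) →
        HasCompactSupport (Function.uncurry V) →
        ∫ p : ℝ × ℝ,
          (nab f f p.1 p.2 / Real.sqrt (1 + (nab f f p.1 p.2) ^ 2)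
              * nab f (nab f V) p.1 p.2
            + Real.sqrt (1 + (nab f f p.1 p.2) ^ 2) * pd2 V p.1 p.2) = 0)
    ↔ (∀ η τ : ℝ,
        nab f (nab f (fun a b =>
            nab f f a b / Real.sqrt (1 + (nab f f a b) ^ 2))) η τ
          + 2 * pd2 f η τ
            * nab f (fun a b =>
                nab f f a b / Real.sqrt (1 + (nab f f a b) ^ 2)) η τ = 0) := by
  have hψ := contDiff_nab hf hf
  set h : ℝ → ℝ → ℝ := fun a b => Real.sqrt (1 + nab f f a b ^ 2) with h_def
  set g : ℝ → ℝ → ℝ := fun a b => nab f f a b / Real.sqrt (1 + nab f f a b ^ 2) with g_def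
  have hh : ContDiff ℝ (⊤ : ℕ∞) (uncurry h) :=
    (contDiff_const.add (hψ.pow 2)).sqrt fun p => by positivity
  have hg : ContDiff ℝ (⊤ : ℕ∞) (uncurry g) :=
    hψ.div hh fun p => by
      have : 0 < Real.sqrt (1 + nab f f p.1 p.2 ^ 2) := by positivity
      exact this.ne'
  have hDg := contDiff_nab hf hg
  set L : ℝ × ℝ → ℝ := fun p => nab f (nab f g) p.1 p.2 + 2 * pd2 f p.1 p.2 * nab f g p.1 p.2
    with L_def
  have hL : Continuous L := (contDiff_nab hf hDg).continuous.add
    ((continuous_const.mul (contDiff_pd2 hf).continuous).mul hDg.continuous)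
  have weak : ∀ V : ℝ → ℝ → ℝ, ContDiff ℝ (⊤ : ℕ∞) (uncurry V) → HasCompactSupport (uncurry V) →
      ∫ p : ℝ × ℝ, (g p.1 p.2 * nab f (nab f V) p.1 p.2 + h p.1 p.2 * pd2 V p.1 p.2)
        = ∫ p : ℝ × ℝ, V p.1 p.2 * L p := by
    intro V hV hc
    rw [integral_mul_nab_nab_add_mul_pd2 hf hg hh hV hc]
    congr 1 with p
    rw [h_def, pd2_sqrt_one_add_sq hψ, pd2_nab_self hf, L_def, g_def]
    ring
  constructor
  · intro H η τ
    have hae : ∀ᵐ p : ℝ × ℝ, L p = 0 := by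
      refine ae_eq_zero_of_integral_contDiff_smul_eq_zero hL.locallyIntegrable fun V hV hc => ?_
      exact (weak (curry V) hV hc).symm.trans (H (curry V) hV hc)
    exact congrFun ((Continuous.ae_eq_iff_eq volume hL continuous_const).1 hae) (η, τ)
  · intro H V hV hc
    refine (weak V hV hc).trans ?_
    have hz : ∀ p, L p = 0 := fun p => H p.1 p.2
    simp [hz]
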